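/- Let V₀ = {v ∈ ℝⁿ : Σ v_i = 0} be the standard (n-1)-dimensional representation of S_n. If U₁, U₂ ⊆ V₀ are linear subspaces with dim U₁ + dim U₂ ≥ n - 1, then there exists a permutation σ ∈ S_n such that U₁ + U₂·σ = V₀. -/

import Mathlib

/-- The standard representation `V₀ = {v ∈ ℝⁿ : Σ vᵢ = 0}` of `S_n`. -/
noncomputable def stdRep (n : ℕ) : Submodule ℝ (Fin n → ℝ) :=
  LinearMap.ker (∑ i : Fin n, LinearMap.proj i : (Fin n → ℝ) →ₗ[ℝ] ℝ)

theorem mem_stdRep {n : ℕ} {v : Fin n → ℝ} : v ∈ stdRep n ↔ ∑ i, v i = 0 := by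
  simp [stdRep, LinearMap.mem_ker, LinearMap.sum_apply]

theorem map_funLeft_le_stdRep {n : ℕ} {U : Submodule ℝ (Fin n → ℝ)} (hU : U ≤ stdRep n)
    (σ : Equiv.Perm (Fin n)) : U.map (LinearMap.funLeft ℝ ℝ σ) ≤ stdRep n := by
  rintro _ ⟨u, hu, rfl⟩
  have hsum := mem_stdRep.1 (hU hu)
  rw [mem_stdRep]
  simpa [LinearMap.funLeft_apply] using (Equiv.sum_comp σ u).trans hsum

theorem finrank_stdRep_le (n : ℕ) : Module.finrank ℝ (stdRep n) ≤ n - 1 := by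
  rcases Nat.eq_zero_or_pos n with rfl | hn
  · simpa using Submodule.finrank_le (stdRep 0)
  · have hne : stdRep n ≠ ⊤ := fun h => by
      have hmem : (fun _ => 1 : Fin n → ℝ) ∈ stdRep n := h ▸ Submodule.mem_top
      simp only [mem_stdRep, Finset.sum_const, Finset.card_univ, Fintype.card_fin,
        nsmul_eq_mul, mul_one, Nat.cast_eq_zero] at hmem
      omega
    have hlt := Submodule.finrank_lt hne
    rw [Module.finrank_fin_fun] at hlt
    omega

/-- Two nonconstant functions are simultaneously separated by some pair of points. -/
theorem exists_ne_and_ne_of_nonconstant {ι α β : Type*} {f : ι → α} {g : ι → β}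
    (hf : ∃ a b, f a ≠ f b) (hg : ∃ a b, g a ≠ g b) : ∃ i j, f i ≠ f j ∧ g i ≠ g j := by
  by_contra! h
  obtain ⟨a, b, hab⟩ := hf
  obtain ⟨c, d, hcd⟩ := hg
  have key : ∀ c, g c = g a := fun c => by
    by_cases hca : f c = f a
    · exact (h c b (hca ▸ hab)).trans (h a b hab).symm
    · exact h c a hca
  exact hcd ((key c).trans (key d).symm)

theorem exists_ne_of_mem_stdRep {n : ℕ} {x : Fin n → ℝ} (hx : x ∈ stdRep n) (hx0 : x ≠ 0) :
    ∃ a b, x a ≠ x b := by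
  by_contra! h
  obtain ⟨a, ha⟩ := Function.ne_iff.1 hx0
  have hsum := mem_stdRep.1 hx
  rw [Fintype.sum_congr _ _ fun i => h i a, Finset.sum_const, Finset.card_univ,
    Fintype.card_fin] at hsum
  exact smul_ne_zero a.pos.ne' ha hsum

/-- If a linear functional does not vanish on `V₀`, then it takes two distinct values on the
standard basis. -/
theorem exists_apply_single_ne {n : ℕ} (φ : (Fin n → ℝ) →ₗ[ℝ] ℝ) {v : Fin n → ℝ}
    (hv : v ∈ stdRep n) (hφ : φ v ≠ 0) :
    ∃ a b, φ (Pi.single a 1) ≠ φ (Pi.single b 1) := by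
  by_contra! h
  apply hφ
  rw [LinearMap.pi_apply_eq_sum_univ φ v]
  rcases isEmpty_or_nonempty (Fin n) with _ | ⟨⟨a⟩⟩
  · simp
  · have hsingle : ∀ i, φ (fun j => if i = j then 1 else 0) = φ (Pi.single a 1) := fun i => by
      rw [← h i a]
      congr 1
      ext j
      simp [Pi.single_apply, eq_comm]
    simp only [hsingle, ← Finset.sum_smul, mem_stdRep.1 hv, zero_smul]

theorem funLeft_swap {n : ℕ} (i j : Fin n) (y : Fin n → ℝ) :
    LinearMap.funLeft ℝ ℝ (Equiv.swap i j) y =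
      y - (y i - y j) • (Pi.single i 1 - Pi.single j 1 : Fin n → ℝ) := by
  ext k
  simp only [LinearMap.funLeft_apply, Equiv.swap_apply_def, Pi.sub_apply, Pi.smul_apply,
    Pi.single_apply, smul_eq_mul]
  split_ifs <;> simp_all

/-- If `U₁ ∩ U₂ ≠ 0` and `U₁ + U₂ ≠ V₀`, then some transposition of the coordinates of `U₂`
strictly enlarges `U₁ + U₂`. -/
theorem exists_swap_sup_lt {n : ℕ} {U₁ U₂ : Submodule ℝ (Fin n → ℝ)}
    (hU₁ : U₁ ≤ stdRep n) (hinf : U₁ ⊓ U₂ ≠ ⊥) (hsup : ¬ stdRep n ≤ U₁ ⊔ U₂) :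
    ∃ i j, U₁ ⊔ U₂ < U₁ ⊔ U₂.map (LinearMap.funLeft ℝ ℝ (Equiv.swap i j)) := by
  obtain ⟨x, ⟨hx₁, hx₂⟩, hx0⟩ := Submodule.exists_mem_ne_zero_of_ne_bot hinf
  obtain ⟨v, hv, hvW⟩ := SetLike.not_le_iff_exists.1 hsup
  obtain ⟨φ, hφv, hφ⟩ := Submodule.exists_le_ker_of_notMem hvW
  obtain ⟨i, j, hxij, hφij⟩ := exists_ne_and_ne_of_nonconstant
    (exists_ne_of_mem_stdRep (hU₁ hx₁) hx0) (exists_apply_single_ne φ hv hφv)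
  have hxij' := sub_ne_zero.2 hxij
  refine ⟨i, j, lt_of_le_not_ge (sup_le le_sup_left fun y hy => ?_) fun hle => ?_⟩
  · set c := (y i - y j) / (x i - x j)
    have hfix : LinearMap.funLeft ℝ ℝ (Equiv.swap i j) (y - c • x) = y - c • x := by
      have hc : (y - c • x) i - (y - c • x) j = 0 := by
        simp only [Pi.sub_apply, Pi.smul_apply, smul_eq_mul, c]
        field_simp
        ring
      rw [funLeft_swap, hc, zero_smul, sub_zero]
    rw [← add_sub_cancel (c • x) y]
    exact Submodule.add_mem_sup (U₁.smul_mem c hx₁)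
      ⟨y - c • x, U₂.sub_mem hy (U₂.smul_mem c hx₂), hfix⟩
  · have hzero := hφ (hle (Submodule.mem_sup_right (Submodule.mem_map_of_mem hx₂)))
    have hxzero : φ x = 0 := hφ (Submodule.mem_sup_left hx₁)
    rw [LinearMap.mem_ker, funLeft_swap, map_sub, map_smul, map_sub, hxzero, zero_sub,
      neg_eq_zero, smul_eq_mul] at hzero
    exact mul_ne_zero hxij' (sub_ne_zero.2 hφij) hzero

/-- If `U₁, U₂ ⊆ V₀` are subspaces of the standard representation of
`S_n` with `dim U₁ + dim U₂ ≥ n - 1`, then there is `σ ∈ S_n` with `U₁ + U₂·σ = V₀`. -/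
theorem exists_perm_sup_eq_stdRep
    (n : ℕ) (U₁ U₂ : Submodule ℝ (Fin n → ℝ))
    (hU₁ : U₁ ≤ stdRep n) (hU₂ : U₂ ≤ stdRep n)
    (hdim : n - 1 ≤ Module.finrank ℝ U₁ + Module.finrank ℝ U₂) :
    ∃ σ : Equiv.Perm (Fin n),
      U₁ ⊔ Submodule.map (LinearMap.funLeft ℝ ℝ σ) U₂ = stdRep n := by
  obtain ⟨σ, hσ⟩ := Finite.exists_max fun σ : Equiv.Perm (Fin n) =>
    Module.finrank ℝ ↥(U₁ ⊔ Submodule.map (LinearMap.funLeft ℝ ℝ σ) U₂)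
  have hle := sup_le hU₁ (map_funLeft_le_stdRep hU₂ σ)
  refine ⟨σ, hle.antisymm ?_⟩
  by_contra hsup
  have hinf : U₁ ⊓ U₂.map (LinearMap.funLeft ℝ ℝ σ) ≠ ⊥ := fun hbot => by
    have hadd := Submodule.finrank_sup_add_finrank_inf_eq U₁ (U₂.map (LinearMap.funLeft ℝ ℝ σ))
    rw [hbot, finrank_bot, add_zero, ← (Submodule.equivMapOfInjective _
      (LinearMap.funLeft_injective_of_surjective ℝ ℝ σ σ.surjective) U₂).finrank_eq] at hadd
    have hlt := Submodule.finrank_lt_finrank_of_lt (lt_of_le_not_ge hle hsup)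
    have hstd := finrank_stdRep_le n
    omega
  obtain ⟨i, j, hlt⟩ := exists_swap_sup_lt hU₁ hinf hsup
  rw [← Submodule.map_comp, ← LinearMap.funLeft_comp] at hlt
  exact (Submodule.finrank_lt_finrank_of_lt hlt).not_ge (hσ (σ * Equiv.swap i j))
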